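/- arXiv:0901.1563 — 7 statements merged into one kernel-verified Lean document; each statement's English description precedes it below -/
import Mathlib

section
/- Let G be a finite simple graph and v a vertex of degree exactly 2 whose two neighbors u and w are non-adjacent. Then there exists a maximum independent set I of G such that either v ∈ I, or both u ∈ I and w ∈ I. (This justifies the vertex-folding reduction: if any single neighbor of v is put in the solution, one could equally well have put v itself.) -/
/-- A set of vertices is independent if its elements are pairwise non-adjacent. -/
def IsIndepSet {V : Type*} (G : SimpleGraph V) (s : Set V) : Prop :=
  s.Pairwise fun a b => ¬ G.Adj a b

/-- A finset of vertices is a maximum independent set if it is independent and of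
maximum cardinality among independent sets. -/
def IsMaxIndepSet {V : Type*} (G : SimpleGraph V) (I : Finset V) : Prop :=
  IsIndepSet G ↑I ∧ ∀ J : Finset V, IsIndepSet G ↑J → J.card ≤ I.card

/-- The independence number of a graph: the maximum cardinality of an independent set. -/
noncomputable def indepNum {V : Type*} (G : SimpleGraph V) : ℕ :=
  sSup {n | ∃ s : Finset V, IsIndepSet G ↑s ∧ s.card = n}

/-- Vertex folding justification: if v has degree exactly 2 with non-adjacent neighbors
u and w, then some maximum independent set contains v, or contains both u and w. -/
theorem vertex_folding {V : Type*} [Fintype V] [DecidableEq V]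
    (G : SimpleGraph V) (v u w : V) (huw : u ≠ w)
    (hN : G.neighborSet v = {u, w}) (hnadj : ¬ G.Adj u w) :
    ∃ I : Finset V, IsMaxIndepSet G I ∧ (v ∈ I ∨ (u ∈ I ∧ w ∈ I)) := by
  have hadj : ∀ x, G.Adj v x ↔ x = u ∨ x = w := by
    intro x
    rw [← SimpleGraph.mem_neighborSet, hN]
    simp
  obtain ⟨I, hI⟩ := G.maximumIndepSet_exists
  have hind : ∀ a ∈ I, ∀ b ∈ I, a ≠ b → ¬ G.Adj a b := fun a ha b hb hab =>
    hI.isIndepSet (Finset.mem_coe.2 ha) (Finset.mem_coe.2 hb) hab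
  have hmax : ∀ J : Finset V, IsIndepSet G ↑J → J.card ≤ I.card := fun J hJ => hI.maximum J hJ
  by_cases hc : v ∈ I ∨ (u ∈ I ∧ w ∈ I)
  · exact ⟨I, ⟨hI.isIndepSet, hmax⟩, hc⟩
  push Not at hc
  obtain ⟨hv, hc⟩ := hc
  -- at most one neighbour of v lies in I; call it x and swap it for v
  obtain ⟨x, hx⟩ : ∃ x, ∀ y ∈ I.erase x, y ≠ u ∧ y ≠ w := by
    by_cases hu : u ∈ I
    · refine ⟨u, fun y hy => ⟨Finset.ne_of_mem_erase hy, ?_⟩⟩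
      rintro rfl
      exact hc hu (Finset.mem_of_mem_erase hy)
    · refine ⟨w, fun y hy => ⟨?_, Finset.ne_of_mem_erase hy⟩⟩
      rintro rfl
      exact hu (Finset.mem_of_mem_erase hy)
  have hnv : ∀ y ∈ I.erase x, ¬ G.Adj v y := by
    intro y hy h
    rcases (hadj y).1 h with h | h
    · exact (hx y hy).1 h
    · exact (hx y hy).2 h
  refine ⟨insert v (I.erase x), ⟨?_, ?_⟩, Or.inl (Finset.mem_insert_self _ _)⟩
  · intro a ha b hb hab
    rcases Finset.mem_insert.1 (Finset.mem_coe.1 ha) with rfl | ha2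
    · rcases Finset.mem_insert.1 (Finset.mem_coe.1 hb) with rfl | hb2
      · exact absurd rfl hab
      · exact hnv b hb2
    · rcases Finset.mem_insert.1 (Finset.mem_coe.1 hb) with rfl | hb2
      · exact fun h => hnv a ha2 h.symm
      · exact hind a (Finset.mem_of_mem_erase ha2) b (Finset.mem_of_mem_erase hb2) hab
  · intro J hJ
    have h1 := hmax J hJ
    rw [Finset.card_insert_of_notMem (fun h => hv (Finset.mem_of_mem_erase h))]
    have h2 := Finset.pred_card_le_card_erase (s := I) (a := x)
    omega
end

section
/- Let G be a finite simple graph, v a vertex, and m a vertex with m ≠ v and m not adjacent to v, such that the set N(v) \ N(m) induces a clique in G (m is a mirror of v). Then α(G) = max( 1 + α(G − N[v]), α(G − {v, m}) ), where G − S denotes the induced subgraph obtained by deleting the vertex set S. -/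
theorem card_le_indepNum_aux {V : Type*} [Finite V] (G : SimpleGraph V) (s : Finset V)
    (hs : IsIndepSet G ↑s) : s.card ≤ indepNum G := by
  have := Fintype.ofFinite V
  refine le_csSup ⟨Fintype.card V, ?_⟩ ⟨s, hs, rfl⟩
  rintro n ⟨t, -, rfl⟩
  exact t.card_le_univ

theorem exists_indepNum_aux {V : Type*} [Finite V] (G : SimpleGraph V) :
    ∃ s : Finset V, IsIndepSet G ↑s ∧ s.card = indepNum G := by
  have := Fintype.ofFinite V
  have h : indepNum G ∈ {n | ∃ s : Finset V, IsIndepSet G ↑s ∧ s.card = n} := by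
    refine Nat.sSup_mem ⟨0, ∅, by simp [IsIndepSet], rfl⟩ ⟨Fintype.card V, ?_⟩
    rintro n ⟨t, -, rfl⟩
    exact t.card_le_univ
  exact h

theorem card_le_induce_aux {V : Type*} [Finite V] (G : SimpleGraph V) (S : Set V)
    (s : Finset V) (hs : IsIndepSet G ↑s) (hS : ∀ x ∈ s, x ∈ S) :
    s.card ≤ indepNum (G.induce S) := by
  classical
  have h := card_le_indepNum_aux (G.induce S) (s.subtype (· ∈ S)) (by
    intro a ha b hb hab
    simp only [Finset.mem_coe, Finset.mem_subtype] at ha hb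
    exact hs ha hb (fun h => hab (Subtype.ext h)))
  rwa [Finset.card_subtype, Finset.filter_true_of_mem hS] at h

theorem exists_induce_aux {V : Type*} [Finite V] (G : SimpleGraph V) (S : Set V) :
    ∃ s : Finset V, IsIndepSet G ↑s ∧ (∀ x ∈ s, x ∈ S) ∧ s.card = indepNum (G.induce S) := by
  obtain ⟨s, hs, hc⟩ := exists_indepNum_aux (G.induce S)
  refine ⟨s.map (Function.Embedding.subtype _), ?_, ?_, by simpa using hc⟩
  · intro a ha b hb hab
    simp only [Finset.coe_map, Set.mem_image, Finset.mem_coe] at ha hb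
    obtain ⟨a, ha, rfl⟩ := ha
    obtain ⟨b, hb, rfl⟩ := hb
    exact hs ha hb (fun h => hab (by rw [h]))
  · intro x hx
    obtain ⟨a, -, rfl⟩ := Finset.mem_map.1 hx
    exact a.2

/-- The mirror branching rule: if m is a mirror of v (m ≠ v, m not adjacent to v, and
N(v) \ N(m) is a clique), then α(G) = max(1 + α(G − N[v]), α(G − {v, m})). -/
theorem mirror_branching {V : Type*} [Fintype V] [DecidableEq V]
    (G : SimpleGraph V) (v m : V) (hne : m ≠ v) (hnadj : ¬ G.Adj v m)
    (hclique : G.IsClique (G.neighborSet v \ G.neighborSet m)) :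
    indepNum G =
      max (1 + indepNum (G.induce ((insert v (G.neighborSet v))ᶜ : Set V)))
        (indepNum (G.induce (({v, m} : Set V)ᶜ))) := by
  classical
  apply le_antisymm
  · obtain ⟨I, hI, hc⟩ := exists_indepNum_aux G
    rw [← hc]
    by_cases h : v ∈ I ∨ m ∈ I
    · apply le_max_of_le_left
      have h1 : (I.filter (fun x => x ∈ insert v (G.neighborSet v))).card ≤ 1 := by
        rw [Finset.card_le_one]
        intro a ha b hb
        simp only [Finset.mem_filter, Set.mem_insert_iff, SimpleGraph.mem_neighborSet] at ha hb
        by_contra hab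
        by_cases hv : v ∈ I
        · have key : ∀ x ∈ I, ¬ G.Adj v x := fun x hx hadj => hI hv hx hadj.ne hadj
          have := key a ha.1
          have := key b hb.1
          grind
        · have hm : m ∈ I := h.resolve_left hv
          have key : ∀ x ∈ I, ¬ G.Adj m x := fun x hx hadj => hI hm hx hadj.ne hadj
          have ha' : G.Adj v a := ha.2.resolve_left (fun e => hv (e ▸ ha.1))
          have hb' : G.Adj v b := hb.2.resolve_left (fun e => hv (e ▸ hb.1))
          exact hI ha.1 hb.1 hab (hclique ⟨ha', key a ha.1⟩ ⟨hb', key b hb.1⟩ hab)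
      have h2 := card_le_induce_aux G ((insert v (G.neighborSet v))ᶜ : Set V)
        (I.filter (fun x => ¬ x ∈ insert v (G.neighborSet v)))
        (hI.mono (by intro x hx; exact (Finset.mem_filter.1 hx).1))
        (fun x hx => (Finset.mem_filter.1 hx).2)
      have h3 := Finset.card_filter_add_card_filter_not (s := I)
        (fun x => x ∈ insert v (G.neighborSet v))
      omega
    · apply le_max_of_le_right
      apply card_le_induce_aux G _ I hI
      intro x hx
      simp only [Set.mem_compl_iff, Set.mem_insert_iff, Set.mem_singleton_iff]
      grind
  · apply max_le
    · obtain ⟨I, hI, hS, hc⟩ := exists_induce_aux G ((insert v (G.neighborSet v))ᶜ : Set V)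
      rw [← hc]
      simp only [Set.mem_compl_iff, Set.mem_insert_iff, SimpleGraph.mem_neighborSet, not_or] at hS
      have hv : v ∉ I := fun h => (hS v h).1 rfl
      have := card_le_indepNum_aux G (insert v I) (by
        intro a ha b hb hab hadj
        simp only [Finset.coe_insert, Set.mem_insert_iff, Finset.mem_coe] at ha hb
        rcases ha with rfl | ha <;> rcases hb with rfl | hb
        · exact hab rfl
        · exact (hS b hb).2 hadj
        · exact (hS a ha).2 hadj.symm
        · exact hI ha hb hab hadj)
      rw [Finset.card_insert_of_notMem hv] at this
      omega
    · obtain ⟨I, hI, -, hc⟩ := exists_induce_aux G (({v, m} : Set V)ᶜ)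
      rw [← hc]
      exact card_le_indepNum_aux G I hI
end

section
/- Let G be a finite simple graph and v a vertex of degree 4 with N(v) = {u1, u2, u3, u4}, such that the subgraph induced by N(v) is exactly the 4-cycle u1–u2–u3–u4–u1 (so u1u2, u2u3, u3u4, u4u1 are edges of G, while u1u3 and u2u4 are not). Then there exists a maximum independent set I of G such that I ∩ N[v] is equal to {v}, or to {u1, u3}, or to {u2, u4}. -/
/-- If the neighborhood of a degree-4 vertex v induces exactly the 4-cycle
u1-u2-u3-u4-u1, then some maximum independent set I satisfies
I ∩ N[v] = {v}, or {u1, u3}, or {u2, u4}. -/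
theorem four_cycle_neighborhood {V : Type*} [Fintype V] [DecidableEq V]
    (G : SimpleGraph V) (v u1 u2 u3 u4 : V)
    (hd : u1 ≠ u2 ∧ u1 ≠ u3 ∧ u1 ≠ u4 ∧ u2 ≠ u3 ∧ u2 ≠ u4 ∧ u3 ≠ u4)
    (hN : G.neighborSet v = {u1, u2, u3, u4})
    (h12 : G.Adj u1 u2) (h23 : G.Adj u2 u3) (h34 : G.Adj u3 u4) (h41 : G.Adj u4 u1)
    (h13 : ¬ G.Adj u1 u3) (h24 : ¬ G.Adj u2 u4) :
    ∃ I : Finset V, IsMaxIndepSet G I ∧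
      ((↑I ∩ (insert v (G.neighborSet v)) = ({v} : Set V)) ∨
        (↑I ∩ (insert v (G.neighborSet v)) = ({u1, u3} : Set V)) ∨
        (↑I ∩ (insert v (G.neighborSet v)) = ({u2, u4} : Set V))) := by
  obtain ⟨I, hI, hmax⟩ : ∃ I : Finset V, IsMaxIndepSet G I := by
    classical
    obtain ⟨I, hI, hm⟩ := Finset.exists_max_image
      (Finset.univ.filter fun s : Finset V => IsIndepSet G (s : Set V)) Finset.card
      ⟨∅, Finset.mem_filter.2 ⟨Finset.mem_univ _, by simp [IsIndepSet]⟩⟩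
    refine ⟨I, (Finset.mem_filter.1 hI).2, fun J hJ => hm J ?_⟩
    exact Finset.mem_filter.2 ⟨Finset.mem_univ _, hJ⟩
  have hadj : ∀ x, G.Adj v x ↔ x = u1 ∨ x = u2 ∨ x = u3 ∨ x = u4 := by
    intro x
    rw [← SimpleGraph.mem_neighborSet, hN]
    simp
  have hno : ∀ a b, a ∈ I → b ∈ I → ¬ G.Adj a b := fun a b ha hb hab =>
    hI (Finset.mem_coe.2 ha) (Finset.mem_coe.2 hb) hab.ne hab
  have hv1 := (hadj u1).2 (by simp)
  have hv2 := (hadj u2).2 (by simp)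
  by_cases c13 : u1 ∈ I ∧ u3 ∈ I
  · refine ⟨I, ⟨hI, hmax⟩, Or.inr (Or.inl ?_)⟩
    obtain ⟨c1, c3⟩ := c13
    have n2 : u2 ∉ I := fun h => hno _ _ c1 h h12
    have n4 : u4 ∉ I := fun h => hno _ _ h c1 h41
    have nv : v ∉ I := fun h => hno _ _ h c1 hv1
    ext x
    simp only [hN, Set.mem_inter_iff, Finset.mem_coe, Set.mem_insert_iff, Set.mem_singleton_iff]
    grind
  by_cases c24 : u2 ∈ I ∧ u4 ∈ I
  · refine ⟨I, ⟨hI, hmax⟩, Or.inr (Or.inr ?_)⟩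
    obtain ⟨c2, c4⟩ := c24
    have n1 : u1 ∉ I := fun h => hno _ _ h c2 h12
    have n3 : u3 ∉ I := fun h => hno _ _ c2 h h23
    have nv : v ∉ I := fun h => hno _ _ h c2 hv2
    ext x
    simp only [hN, Set.mem_inter_iff, Finset.mem_coe, Set.mem_insert_iff, Set.mem_singleton_iff]
    grind
  -- otherwise at most one neighbour of v lies in I
  obtain ⟨w, hw, hwu⟩ : ∃ w, G.Adj v w ∧ ∀ x ∈ I, G.Adj v x → x = w := by
    have e12 : ¬ (u1 ∈ I ∧ u2 ∈ I) := fun h => hno _ _ h.1 h.2 h12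
    have e23 : ¬ (u2 ∈ I ∧ u3 ∈ I) := fun h => hno _ _ h.1 h.2 h23
    have e34 : ¬ (u3 ∈ I ∧ u4 ∈ I) := fun h => hno _ _ h.1 h.2 h34
    have e41 : ¬ (u4 ∈ I ∧ u1 ∈ I) := fun h => hno _ _ h.1 h.2 h41
    by_cases h : ∃ w ∈ I, G.Adj v w
    · obtain ⟨w, hwI, hw⟩ := h
      refine ⟨w, hw, fun x hx hvx => ?_⟩
      rw [hadj] at hw hvx
      rcases hw with rfl | rfl | rfl | rfl <;> rcases hvx with rfl | rfl | rfl | rfl <;> try rfl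
      all_goals exfalso
      all_goals first | exact c13 ⟨hwI, hx⟩ | exact c13 ⟨hx, hwI⟩ | exact c24 ⟨hwI, hx⟩ | exact c24 ⟨hx, hwI⟩ | exact e12 ⟨hwI, hx⟩ | exact e12 ⟨hx, hwI⟩ | exact e23 ⟨hwI, hx⟩ | exact e23 ⟨hx, hwI⟩ | exact e34 ⟨hwI, hx⟩ | exact e34 ⟨hx, hwI⟩ | exact e41 ⟨hwI, hx⟩ | exact e41 ⟨hx, hwI⟩
    · exact ⟨u1, hv1, fun x hx hvx => absurd ⟨x, hx, hvx⟩ h⟩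
  refine ⟨insert v (I.erase w), ⟨?_, fun J hJ => (hmax J hJ).trans ?_⟩, Or.inl ?_⟩
  · intro a ha b hb hab h
    simp only [Finset.coe_insert, Set.mem_insert_iff, Finset.mem_coe, Finset.mem_erase] at ha hb
    rcases ha with rfl | ⟨haw, ha⟩ <;> rcases hb with rfl | ⟨hbw, hb⟩
    · exact hab rfl
    · exact hbw (hwu _ hb h)
    · exact haw (hwu _ ha h.symm)
    · exact hno _ _ ha hb h
  · by_cases hv : v ∈ I
    · have : w ∉ I := fun h => hno _ _ hv h hw
      rw [Finset.erase_eq_of_notMem this, Finset.insert_eq_of_mem hv]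
    · rw [Finset.card_insert_of_notMem (fun h => hv (Finset.mem_of_mem_erase h))]
      have := Finset.pred_card_le_card_erase (s := I) (a := w)
      omega
  · ext x
    simp only [Set.mem_inter_iff, Finset.mem_coe, Set.mem_insert_iff, Set.mem_singleton_iff,
      Finset.mem_insert, Finset.mem_erase, SimpleGraph.mem_neighborSet]
    constructor
    · rintro ⟨h | ⟨h, hx⟩, h' | h'⟩
      · exact h
      · exact h
      · exact h'
      · exact absurd (hwu _ hx h') h
    · rintro rfl
      exact ⟨Or.inl rfl, Or.inl rfl⟩
end

section
/- Let G be a finite simple graph, u ≠ v two vertices, and C a set of vertices with u, v ∉ C such that every edge of G with an endpoint in C has its other endpoint in C ∪ {u, v}. Suppose α(G[C ∪ {u}]) = α(G[C ∪ {v}]) = α(G[C ∪ {u, v}]) = α(G[C]) + 1. Let G' be the graph on vertex set V \ C whose edges are those of G[V \ C] together with the additional edge uv. Then α(G) = α(G[C]) + α(G'). -/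
theorem card_le_aux {V : Type*} [Fintype V] (G : SimpleGraph V) (T : Finset V)
    (h : IsIndepSet G ↑T) : T.card ≤ indepNum G := by
  apply le_csSup
  · refine ⟨Fintype.card V, ?_⟩
    rintro n ⟨s, -, rfl⟩
    exact Finset.card_le_univ s
  · exact ⟨T, h, rfl⟩

theorem exists_aux {V : Type*} [Fintype V] (G : SimpleGraph V) :
    ∃ T : Finset V, IsIndepSet G ↑T ∧ T.card = indepNum G := by
  have := Nat.sSup_mem (s := {n | ∃ s : Finset V, IsIndepSet G ↑s ∧ s.card = n})
    ⟨0, ∅, by simp [IsIndepSet], rfl⟩ (by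
      refine ⟨Fintype.card V, ?_⟩
      rintro n ⟨s, -, rfl⟩
      exact Finset.card_le_univ s)
  exact this

theorem card_le_induce {V : Type*} [Fintype V] (G : SimpleGraph V) (S : Set V)
    (T : Finset V) (hTS : ∀ x ∈ T, x ∈ S)
    (h : IsIndepSet G ↑T) : T.card ≤ indepNum (G.induce S) := by
  classical
  have h1 := card_le_aux (G.induce S) (T.subtype (· ∈ S)) (by
    intro a ha b hb hab
    simp only [Finset.mem_coe, Finset.mem_subtype] at ha hb
    simpa using h ha hb (fun e => hab (Subtype.ext e)))
  rwa [Finset.card_subtype, Finset.filter_true_of_mem hTS] at h1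

theorem exists_induce {V : Type*} [Fintype V] (G : SimpleGraph V) (S : Set V) :
    ∃ T : Finset V, (∀ x ∈ T, x ∈ S) ∧ IsIndepSet G ↑T ∧ T.card = indepNum (G.induce S) := by
  classical
  obtain ⟨T, hT, hc⟩ := exists_aux (G.induce S)
  refine ⟨T.map (Function.Embedding.subtype _), ?_, ?_, by simpa using hc⟩
  · intro x hx
    simp only [Finset.mem_map] at hx
    obtain ⟨y, -, rfl⟩ := hx
    exact y.2
  · intro a ha b hb hab
    simp only [Finset.coe_map, Set.mem_image] at ha hb
    obtain ⟨a, ha, rfl⟩ := ha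
    obtain ⟨b, hb, rfl⟩ := hb
    simpa using hT ha hb (fun e => hab (by rw [e]))

theorem union_aux {V : Type*} [Fintype V] [DecidableEq V]
    (G : SimpleGraph V) (u v : V) (C : Set V)
    (hsep : ∀ a b : V, G.Adj a b → a ∈ C → b ∈ C ∪ {u, v})
    (K J : Finset V) (hK : ∀ x ∈ K, x ∈ C) (hJ : ∀ x ∈ J, x ∉ C)
    (iK : IsIndepSet G ↑K) (iJ : IsIndepSet G ↑J)
    (ku : u ∈ J → ∀ x ∈ K, ¬ G.Adj x u) (kv : v ∈ J → ∀ x ∈ K, ¬ G.Adj x v) :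
    K.card + J.card ≤ indepNum G := by
  have hd : Disjoint K J := Finset.disjoint_left.2 fun x hx hx' => hJ x hx' (hK x hx)
  rw [← Finset.card_union_of_disjoint hd]
  apply card_le_aux
  have key : ∀ a ∈ K, ∀ b ∈ J, ¬ G.Adj a b := by
    intro a ha b hb hab
    rcases hsep a b hab (hK a ha) with h | h | h
    · exact hJ b hb h
    · subst h; exact ku hb a ha hab
    · rw [Set.mem_singleton_iff] at h
      subst h; exact kv hb a ha hab
  intro a ha b hb hab
  simp only [Finset.coe_union, Set.mem_union, Finset.mem_coe] at ha hb
  rcases ha with ha | ha <;> rcases hb with hb | hb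
  · exact iK ha hb hab
  · exact key a ha b hb
  · exact fun h => key b hb a ha h.symm
  · exact iJ ha hb hab

/-- A set `K ⊆ C` of size α(G[C]) avoiding the neighbours of `u`. -/
theorem exists_avoid {V : Type*} [Fintype V] [DecidableEq V]
    (G : SimpleGraph V) (u : V) (C : Set V)
    (h1 : indepNum (G.induce (C ∪ {u})) = indepNum (G.induce C) + 1) :
    ∃ K : Finset V, (∀ x ∈ K, x ∈ C) ∧ IsIndepSet G ↑K ∧ K.card = indepNum (G.induce C) ∧
      ∀ x ∈ K, ¬ G.Adj x u := by
  obtain ⟨T, hT, iT, cT⟩ := exists_induce G (C ∪ {u})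
  have huT : u ∈ T := by
    by_contra hn
    have := card_le_induce G C T (fun x hx => by
      rcases hT x hx with h | h
      · exact h
      · rw [Set.mem_singleton_iff] at h
        subst h; exact absurd hx hn) iT
    omega
  refine ⟨T.erase u, ?_, ?_, ?_, ?_⟩
  · intro x hx
    rw [Finset.mem_erase] at hx
    rcases hT x hx.2 with h | h
    · exact h
    · exact absurd h hx.1
  · exact iT.mono (by simp)
  · rw [Finset.card_erase_of_mem huT]; omega
  · intro x hx
    rw [Finset.mem_erase] at hx
    exact iT hx.2 huT hx.1

/-- Two-separator rule with an added edge: if {u, v} cuts off C and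
α(G[C ∪ {u}]) = α(G[C ∪ {v}]) = α(G[C ∪ {u, v}]) = α(G[C]) + 1, then letting G' be
G[V \ C] with an extra edge between u and v, α(G) = α(G[C]) + α(G'). -/
theorem two_separator_add_edge {V : Type*} [Fintype V] [DecidableEq V]
    (G : SimpleGraph V) (u v : V) (huv : u ≠ v) (C : Set V) (hu : u ∉ C) (hv : v ∉ C)
    (hsep : ∀ a b : V, G.Adj a b → a ∈ C → b ∈ C ∪ {u, v})
    (h1 : indepNum (G.induce (C ∪ {u})) = indepNum (G.induce C) + 1)
    (h2 : indepNum (G.induce (C ∪ {v})) = indepNum (G.induce C) + 1)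
    (h3 : indepNum (G.induce (C ∪ {u, v})) = indepNum (G.induce C) + 1) :
    indepNum G =
      indepNum (G.induce C) +
        indepNum
          (G.induce (Cᶜ : Set V) ⊔
            SimpleGraph.fromEdgeSet
              {s((⟨u, hu⟩ : (Cᶜ : Set V)), (⟨v, hv⟩ : (Cᶜ : Set V)))}) := by
  classical
  have hG : (G.induce (Cᶜ : Set V) ⊔ SimpleGraph.fromEdgeSet
      {s((⟨u, hu⟩ : (Cᶜ : Set V)), (⟨v, hv⟩ : (Cᶜ : Set V)))}) =
      (G ⊔ SimpleGraph.fromEdgeSet {s(u, v)}).induce (Cᶜ : Set V) := by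
    ext a b
    simp [Subtype.ext_iff]
  rw [hG]
  have hadj : ∀ a b, (G ⊔ SimpleGraph.fromEdgeSet {s(u, v)}).Adj a b ↔
      G.Adj a b ∨ (a = u ∧ b = v ∨ a = v ∧ b = u) := by
    intro a b
    simp only [SimpleGraph.sup_adj, SimpleGraph.fromEdgeSet_adj, Set.mem_singleton_iff,
      Sym2.eq_iff]
    grind
  generalize G ⊔ SimpleGraph.fromEdgeSet {s(u, v)} = H at hadj
  apply le_antisymm
  · obtain ⟨I, hI, hc⟩ := exists_aux G
    rw [← hc, ← Finset.card_filter_add_card_filter_not (s := I) (· ∈ C)]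
    have mH : ∀ T : Finset V, T ⊆ I → (∀ x ∈ T, x ∉ C) → ¬ (u ∈ T ∧ v ∈ T) →
        T.card ≤ indepNum (H.induce (Cᶜ : Set V)) := by
      intro T hT hTC hn
      apply card_le_induce H _ T hTC
      intro a ha b hb hab h
      rw [hadj] at h
      rcases h with h | ⟨rfl, rfl⟩ | ⟨rfl, rfl⟩
      · exact hI (hT ha) (hT hb) hab h
      · exact hn ⟨ha, hb⟩
      · exact hn ⟨hb, ha⟩
    by_cases hb : u ∈ I ∧ v ∈ I
    · have e1 := mH ((I.filter (· ∉ C)).erase u)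
        ((Finset.erase_subset _ _).trans (Finset.filter_subset _ _)) (by simp) (by simp)
      rw [Finset.card_erase_of_mem (by simp [hb.1, hu])] at e1
      have e2 := card_le_induce G (C ∪ {u, v}) (insert u (insert v (I.filter (· ∈ C))))
        (by intro x hx; simp at hx ⊢; tauto)
        (hI.mono (by intro x hx; simp at hx ⊢; rcases hx with rfl | rfl | h <;> tauto))
      rw [Finset.card_insert_of_notMem (by simp [huv, hu]),
        Finset.card_insert_of_notMem (by simp [hv])] at e2
      omega
    · have e1 := mH (I.filter (· ∉ C)) (Finset.filter_subset _ _) (by simp)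
        (by simp; tauto)
      have e2 := card_le_induce G C (I.filter (· ∈ C)) (by simp)
        (hI.mono (by intro x hx; simp at hx ⊢; exact hx.1))
      omega
  · obtain ⟨J, hJ, iJ, cJ⟩ := exists_induce H (Cᶜ : Set V)
    rw [← cJ]
    have iJG : IsIndepSet G ↑J := fun a ha b hb hab h =>
      iJ ha hb hab ((hadj a b).2 (Or.inl h))
    have nb : u ∈ J → v ∉ J := fun a b =>
      iJ a b huv ((hadj u v).2 (Or.inr (Or.inl ⟨rfl, rfl⟩)))
    by_cases huJ : u ∈ J
    · obtain ⟨K, hK, iK, cK, aK⟩ := exists_avoid G u C h1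
      rw [← cK]
      exact union_aux G u v C hsep K J hK hJ iK iJG (fun _ => aK) (fun h => absurd h (nb huJ))
    · obtain ⟨K, hK, iK, cK, aK⟩ := exists_avoid G v C h2
      rw [← cK]
      exact union_aux G u v C hsep K J hK hJ iK iJG (fun h => absurd h huJ) (fun _ => aK)
end

section
/- Let G be a finite simple graph and let v, t be two distinct vertices with N(v) = N(t) = {a, b, c} for three distinct vertices a, b, c (so v and t both have degree 3 and the same neighborhood, and v, t are non-adjacent). If at least one of the pairs among {a, b, c} is an edge of G, then there exists a maximum independent set of G containing both v and t. -/
/-- If v and t are distinct vertices with the same neighborhood {a, b, c} (a, b, c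
distinct) and some pair among a, b, c is an edge, then some maximum independent set
contains both v and t. -/
theorem one_tree_with_edge {V : Type*} [Fintype V] [DecidableEq V]
    (G : SimpleGraph V) (v t a b c : V) (hvt : v ≠ t)
    (habc : a ≠ b ∧ a ≠ c ∧ b ≠ c)
    (hNv : G.neighborSet v = {a, b, c}) (hNt : G.neighborSet t = {a, b, c})
    (hedge : G.Adj a b ∨ G.Adj a c ∨ G.Adj b c) :
    ∃ I : Finset V, IsMaxIndepSet G I ∧ v ∈ I ∧ t ∈ I := by
  classical
  have hv : ∀ x, G.Adj v x ↔ x ∈ ({a, b, c} : Finset V) := by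
    intro x; rw [← SimpleGraph.mem_neighborSet, hNv]; simp
  have ht : ∀ x, G.Adj t x ↔ x ∈ ({a, b, c} : Finset V) := by
    intro x; rw [← SimpleGraph.mem_neighborSet, hNt]; simp
  obtain ⟨S, hS, hmax⟩ : ∃ S : Finset V, IsIndepSet G ↑S ∧
      ∀ J : Finset V, IsIndepSet G ↑J → J.card ≤ S.card := by
    obtain ⟨S, hS, hm⟩ := Finset.exists_max_image
      (Finset.univ.filter fun s : Finset V => IsIndepSet G ↑s) Finset.card
      ⟨∅, Finset.mem_filter.2 ⟨Finset.mem_univ _, by simp [IsIndepSet]⟩⟩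
    simp only [Finset.mem_filter, Finset.mem_univ, true_and] at hS hm
    exact ⟨S, hS, hm⟩
  have hS' : ∀ x ∈ S, ∀ y ∈ S, ¬ G.Adj x y := by
    intro x hx y hy hxy
    exact hS hx hy hxy.ne hxy
  obtain ⟨N, hN⟩ : ∃ N : Finset V, N = {a, b, c} := ⟨_, rfl⟩
  rw [← hN] at hv ht
  have hvN : v ∉ N := fun h => G.loopless.irrefl v ((hv v).2 h)
  have htN : t ∉ N := fun h => G.loopless.irrefl t ((ht t).2 h)
  have hvt' : ¬ G.Adj v t := fun h => htN ((hv t).1 h)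
  refine ⟨(S \ N) ∪ {v, t}, ⟨?_, ?_⟩, by simp, by simp⟩
  · intro x hx y hy hne hxy
    have h1 := hxy.symm
    simp only [Finset.coe_union, Finset.coe_sdiff, Finset.coe_insert, Finset.coe_singleton,
      Set.mem_union, Set.mem_sdiff, Finset.mem_coe, Set.mem_insert_iff,
      Set.mem_singleton_iff] at hx hy
    rcases hx with ⟨hx, hxN⟩ | rfl | rfl <;> rcases hy with ⟨hy, hyN⟩ | rfl | rfl <;> grind
  · intro J hJ
    refine (hmax J hJ).trans ?_
    have hsplit : (S \ N).card + (S ∩ N).card = S.card := Finset.card_sdiff_add_card_inter S N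
    rcases Finset.eq_empty_or_nonempty (S ∩ N) with he | ⟨x, hx⟩
    · rw [he, Finset.card_empty, Nat.add_zero] at hsplit
      rw [← hsplit]
      exact Finset.card_le_card Finset.subset_union_left
    · rw [Finset.mem_inter] at hx
      have hvS : v ∉ S := fun h => hS' v h x hx.1 ((hv x).2 hx.2)
      have htS : t ∉ S := fun h => hS' t h x hx.1 ((ht x).2 hx.2)
      have hd : Disjoint (S \ N) {v, t} := by
        simp [hvS, htS]
      rw [Finset.card_union_of_disjoint hd, Finset.card_pair hvt, ← hsplit]
      have hlt : (S ∩ N).card < N.card := by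
        apply Finset.card_lt_card
        refine ⟨Finset.inter_subset_right, fun hsub => ?_⟩
        have hm : ∀ y ∈ N, y ∈ S := fun y hy => (Finset.mem_inter.1 (hsub hy)).1
        have ha := hm a (by simp [hN])
        have hb := hm b (by simp [hN])
        have hc := hm c (by simp [hN])
        rcases hedge with h | h | h
        · exact hS' _ ha _ hb h
        · exact hS' _ ha _ hc h
        · exact hS' _ hb _ hc h
      have h3 : N.card ≤ 3 := hN ▸ Finset.card_le_three
      omega
end

section
/- Let G be a finite simple graph and let v, t be two distinct vertices with N(v) = N(t) = {a, b, c} for three distinct vertices a, b, c (so v and t both have degree 3 and the same neighborhood, and v, t are non-adjacent). If a, b, c are pairwise non-adjacent, then there exists a maximum independent set I of G such that either {v, t} ⊆ I or {a, b, c} ⊆ I. -/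
/-- If v and t are distinct vertices with the same neighborhood {a, b, c} (a, b, c
distinct and pairwise non-adjacent), then some maximum independent set contains both
v and t, or contains all of a, b, c. -/
theorem one_tree_no_edge {V : Type*} [Fintype V] [DecidableEq V]
    (G : SimpleGraph V) (v t a b c : V) (hvt : v ≠ t)
    (habc : a ≠ b ∧ a ≠ c ∧ b ≠ c)
    (hNv : G.neighborSet v = {a, b, c}) (hNt : G.neighborSet t = {a, b, c})
    (hab : ¬ G.Adj a b) (hac : ¬ G.Adj a c) (hbc : ¬ G.Adj b c) :
    ∃ I : Finset V, IsMaxIndepSet G I ∧ ((v ∈ I ∧ t ∈ I) ∨ (a ∈ I ∧ b ∈ I ∧ c ∈ I)) := by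
  classical
  have hv : ∀ x, G.Adj v x ↔ x = a ∨ x = b ∨ x = c := fun x => by
    rw [← SimpleGraph.mem_neighborSet, hNv]; simp
  have ht : ∀ x, G.Adj t x ↔ x = a ∨ x = b ∨ x = c := fun x => by
    rw [← SimpleGraph.mem_neighborSet, hNt]; simp
  obtain ⟨I, hI, hmax⟩ : ∃ I : Finset V, IsIndepSet G ↑I ∧
      ∀ J : Finset V, IsIndepSet G ↑J → J.card ≤ I.card := by
    obtain ⟨I, hI, hm⟩ := Finset.exists_max_image
      (Finset.univ.filter fun J : Finset V => IsIndepSet G ↑J) Finset.card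
      ⟨∅, Finset.mem_filter.2 ⟨Finset.mem_univ _, by simp [IsIndepSet]⟩⟩
    refine ⟨I, (Finset.mem_filter.1 hI).2, fun J hJ => hm J ?_⟩
    simpa using hJ
  by_cases hall : a ∈ I ∧ b ∈ I ∧ c ∈ I
  · exact ⟨I, ⟨hI, hmax⟩, Or.inr hall⟩
  have hvv : ¬ G.Adj v v := G.irrefl
  have htt : ¬ G.Adj t t := G.irrefl
  have hvt' : ¬ G.Adj v t := fun h => htt ((ht t).2 ((hv t).1 h))
  refine ⟨(I \ {a, b, c}) ∪ {v, t}, ⟨?_, fun J hJ => (hmax J hJ).trans ?_⟩, Or.inl (by simp)⟩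
  · intro x hx y hy hxy hadj
    have hadj' := hadj.symm
    simp only [Finset.coe_union, Finset.coe_sdiff, Finset.coe_insert, Finset.coe_singleton,
      Set.mem_union, Set.mem_sdiff, Set.mem_insert_iff, Set.mem_singleton_iff,
      Finset.mem_coe] at hx hy
    rcases hx with ⟨hx, hx'⟩ | rfl | rfl
    · rcases hy with ⟨hy, hy'⟩ | rfl | rfl
      · exact hI hx hy hxy hadj
      · exact hx' ((hv x).1 hadj')
      · exact hx' ((ht x).1 hadj')
    · have := (hv y).1 hadj
      have := (ht y).2 this
      rcases hy with ⟨hy, hy'⟩ | rfl | rfl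
      · tauto
      · exact hxy rfl
      · exact hvt' hadj
    · have := (ht y).1 hadj
      rcases hy with ⟨hy, hy'⟩ | rfl | rfl
      · tauto
      · exact hvt' hadj'
      · exact hxy rfl
  · by_cases hne : I ∩ {a, b, c} = ∅
    · apply Finset.card_le_card
      intro x hx
      have : x ∉ I ∩ {a, b, c} := by simp [hne]
      simp only [Finset.mem_union, Finset.mem_sdiff, Finset.mem_inter] at this ⊢
      tauto
    · obtain ⟨x, hx⟩ := Finset.nonempty_iff_ne_empty.2 hne
      obtain ⟨hxI, hxabc⟩ := Finset.mem_inter.1 hx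
      have hx3 : x = a ∨ x = b ∨ x = c := by simpa using hxabc
      have avx := (hv x).2 hx3
      have atx := (ht x).2 hx3
      have hvI : v ∉ I := fun h => hI h hxI avx.ne avx
      have htI : t ∉ I := fun h => hI h hxI atx.ne atx
      have hdisj : Disjoint (I \ {a, b, c}) {v, t} := by
        rw [Finset.disjoint_left]
        intro y hy hy'
        have hyI := (Finset.mem_sdiff.1 hy).1
        have : y = v ∨ y = t := by simpa using hy'
        rcases this with rfl | rfl
        · exact hvI hyI
        · exact htI hyI
      rw [Finset.card_union_of_disjoint hdisj, Finset.card_pair hvt]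
      have h3 : ({a, b, c} : Finset V).card ≤ 3 := Finset.card_le_three
      have hlt : (I ∩ {a, b, c}).card < ({a, b, c} : Finset V).card := by
        apply Finset.card_lt_card
        refine ⟨Finset.inter_subset_right, fun h => hall ?_⟩
        refine ⟨(Finset.mem_inter.1 (h ?_)).1, (Finset.mem_inter.1 (h ?_)).1,
          (Finset.mem_inter.1 (h ?_)).1⟩ <;> simp
      have := Finset.card_sdiff_add_card_inter I {a, b, c}
      omega
end

section
/- Let G be a finite simple graph and let a, b be two distinct non-adjacent vertices with N(a) = N(b) = {v, x, y} for three distinct vertices v, x, y that are pairwise non-adjacent. Then there exists a maximum independent set I of G such that either {a, b} ⊆ I or {v, x, y} ⊆ I. (In an optimum solution one either takes 2 vertices from {a, b, v, x, y}, hence a and b, or 3 vertices, hence v, x and y.) -/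
/-- If a and b are distinct non-adjacent vertices with the same neighborhood {v, x, y}
(v, x, y distinct and pairwise non-adjacent), then some maximum independent set
contains both a and b, or contains all of v, x, y. -/
theorem folding_three_neighbors {V : Type*} [Fintype V] [DecidableEq V]
    (G : SimpleGraph V) (a b v x y : V) (hab : a ≠ b) (hnadj : ¬ G.Adj a b)
    (hvxy : v ≠ x ∧ v ≠ y ∧ x ≠ y)
    (hNa : G.neighborSet a = {v, x, y}) (hNb : G.neighborSet b = {v, x, y})
    (hvx : ¬ G.Adj v x) (hvy : ¬ G.Adj v y) (hxy : ¬ G.Adj x y) :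
    ∃ I : Finset V, IsMaxIndepSet G I ∧ ((a ∈ I ∧ b ∈ I) ∨ (v ∈ I ∧ x ∈ I ∧ y ∈ I)) := by
  classical
  obtain ⟨I, hI⟩ := G.maximumIndepSet_exists
  have hInd : IsIndepSet G ↑I := hI.isIndepSet
  have hmax : ∀ J : Finset V, IsIndepSet G ↑J → J.card ≤ I.card := fun J hJ => hI.maximum J hJ
  by_cases hall : v ∈ I ∧ x ∈ I ∧ y ∈ I
  · exact ⟨I, ⟨hInd, hmax⟩, Or.inr hall⟩
  have ha : ∀ w, G.Adj a w ↔ w ∈ ({v, x, y} : Finset V) := fun w => by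
    rw [← SimpleGraph.mem_neighborSet, hNa]; simp
  have hb : ∀ w, G.Adj b w ↔ w ∈ ({v, x, y} : Finset V) := fun w => by
    rw [← SimpleGraph.mem_neighborSet, hNb]; simp
  have hS : ({v, x, y} : Finset V).card = 3 :=
    Finset.card_eq_three.2 ⟨v, x, y, hvxy.1, hvxy.2.1, hvxy.2.2, rfl⟩
  have hnot : ¬ ({v, x, y} : Finset V) ⊆ I := fun h => hall
    ⟨h (by simp), h (by simp), h (by simp)⟩
  generalize ({v, x, y} : Finset V) = S at ha hb hS hnot
  have hJ : IsIndepSet G ↑((I \ S) ∪ {a, b}) := by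
    intro p hp q hq hpq hadj
    simp only [Finset.coe_union, Finset.coe_sdiff, Finset.coe_insert, Finset.coe_singleton,
      Set.mem_union, Set.mem_diff, Finset.mem_coe, Set.mem_insert_iff,
      Set.mem_singleton_iff] at hp hq
    rcases hp with ⟨hp, hpS⟩ | rfl | rfl
    · rcases hq with ⟨hq, hqS⟩ | rfl | rfl
      · exact hInd hp hq hpq hadj
      · exact hpS ((ha p).1 hadj.symm)
      · exact hpS ((hb p).1 hadj.symm)
    · rcases hq with ⟨hq, hqS⟩ | rfl | rfl
      · exact hqS ((ha q).1 hadj)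
      · exact hpq rfl
      · exact hnadj hadj
    · rcases hq with ⟨hq, hqS⟩ | rfl | rfl
      · exact hqS ((hb q).1 hadj)
      · exact hnadj hadj.symm
      · exact hpq rfl
  have hcard : I.card ≤ ((I \ S) ∪ {a, b}).card := by
    by_cases hd : ∃ w ∈ I, w ∈ S
    · obtain ⟨w, hwI, hwS⟩ := hd
      have haw := (ha w).2 hwS
      have hbw := (hb w).2 hwS
      have haI : a ∉ I := fun h => hInd h hwI haw.ne haw
      have hbI : b ∉ I := fun h => hInd h hwI hbw.ne hbw
      have hdis : Disjoint (I \ S) {a, b} := by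
        rw [Finset.disjoint_right]
        intro p hp
        simp only [Finset.mem_insert, Finset.mem_singleton] at hp
        rcases hp with rfl | rfl <;> simp [haI, hbI]
      rw [Finset.card_union_of_disjoint hdis, Finset.card_pair hab]
      have h1 := Finset.card_sdiff_add_card_inter I S
      have h2 : (I ∩ S).card < S.card := Finset.card_lt_card
        ⟨Finset.inter_subset_right, fun h => hnot (h.trans Finset.inter_subset_left)⟩
      omega
    · refine Finset.card_le_card fun p hp => ?_
      simp only [Finset.mem_union, Finset.mem_sdiff]
      exact Or.inl ⟨hp, fun h => hd ⟨p, hp, h⟩⟩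
  exact ⟨_, ⟨hJ, fun K hK => (hmax K hK).trans hcard⟩, Or.inl ⟨by simp, by simp⟩⟩
end
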